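/- arXiv:1606.02760 — 3 statements merged into one kernel-verified Lean document; each statement's English description precedes it below -/
import Mathlib

section
/- For every invertible n×n complex matrix g there exist a unique matrix M in column-reduced form and an invertible upper-triangular complex matrix b such that g = M·b. Here a matrix M is in column-reduced form if there is a permutation w of {1,…,n} such that M_{w(j),j} = 1 for every column j, and for every entry position (i,j) with i ≠ w(j), M_{i,j} = 0 unless both i < w(j) and j < w⁻¹(i). -/
open Matrix

/-- A matrix `M` is in column-reduced form if there is a permutation `w` of the
columns such that `M` has a `1` in position `(w j, j)` for each column `j`, and
every other entry `M i j` vanishes unless it lies strictly above the `1` in its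
column (`i < w j`) and strictly to the left of the `1` in its row (`j < w⁻¹ i`). -/
def IsColumnReduced {n : ℕ} (M : Matrix (Fin n) (Fin n) ℂ) : Prop :=
  ∃ w : Equiv.Perm (Fin n),
    (∀ j, M (w j) j = 1) ∧
    ∀ i j, i ≠ w j → ¬(i < w j ∧ j < w⁻¹ i) → M i j = 0

/-- Eliminating column by column with invertible upper-triangular column operations: after `m`
steps each of the first `m` columns has its lowest nonzero entry equal to `1`, with zeros to the
right of that entry. -/
lemma exists_upperTriangular_mul_partially_reduced {n : ℕ} (g : Matrix (Fin n) (Fin n) ℂ)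
    (hg : IsUnit g) (m : ℕ) (hm : m ≤ n) :
    ∃ (c : Matrix (Fin n) (Fin n) ℂ) (w : Fin n → Fin n),
      IsUnit c ∧ c.BlockTriangular id ∧
        ∀ j : Fin n, (j : ℕ) < m →
          (g * c) (w j) j = 1 ∧ (∀ i, w j < i → (g * c) i j = 0) ∧
            ∀ k, j < k → (g * c) (w j) k = 0 := by
  induction m with
  | zero => exact ⟨1, id, isUnit_one, blockTriangular_one, by simp⟩
  | succ m ih =>
    obtain ⟨c, w, hc, hct, h⟩ := ih (by omega)
    let q : Fin n := ⟨m, hm⟩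
    obtain ⟨M, hM⟩ : ∃ M, M = g * c := ⟨_, rfl⟩
    rw [← hM] at h
    have hMu : IsUnit M := hM ▸ hg.mul hc
    have hne : ∃ i, M i q ≠ 0 := by
      by_contra! hz
      exact ((isUnit_iff_isUnit_det M).1 hMu).ne_zero (det_eq_zero_of_column_eq_zero q hz)
    obtain ⟨r, hr, hrmax⟩ : ∃ r, M r q ≠ 0 ∧ ∀ i, r < i → M i q = 0 := by
      obtain ⟨r, hr⟩ := (Set.toFinite {i | M i q ≠ 0}).exists_maximal hne
      refine ⟨r, hr.prop, fun i hi => ?_⟩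
      by_contra hi0
      exact hr.not_gt hi0 hi
    let u : Fin n → ℂ := fun k =>
      if k < q then 0 else if k = q then (M r q)⁻¹ - 1 else -M r k / M r q
    let E : Matrix (Fin n) (Fin n) ℂ := 1 + vecMulVec (Pi.single q 1) u
    have hEt : E.BlockTriangular id := by
      refine blockTriangular_one.add fun i k hki => ?_
      simp only [id] at hki
      by_cases hi : i = q
      · subst hi
        simp [vecMulVec_apply, u, hki]
      · simp [vecMulVec_apply, hi]
    have hEu : IsUnit E := by
      rw [isUnit_iff_isUnit_det, det_of_isUpperTriangular hEt, isUnit_iff_ne_zero,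
        Finset.prod_ne_zero_iff]
      intro i _
      by_cases hi : i = q
      · subst hi
        simp [E, vecMulVec_apply, u, hr]
      · simp [E, vecMulVec_apply, hi]
    have hME : ∀ i k, (g * (c * E)) i k = M i k + M i q * u k := by
      intro i k
      rw [← Matrix.mul_assoc, ← hM, Matrix.mul_add, Matrix.mul_one, mul_vecMulVec]
      simp [vecMulVec_apply]
    refine ⟨c * E, Function.update w q r, hc.mul hEu, hct.mul hEt, fun j hj => ?_⟩
    simp only [hME]
    rcases Nat.lt_succ_iff_lt_or_eq.1 hj with hj | hj
    · have hjq : j < q := hj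
      obtain ⟨h1, h2, h3⟩ := h j hj
      have hu : u j = 0 := by simp [u, hjq]
      rw [Function.update_of_ne hjq.ne]
      refine ⟨by simp [h1, hu], fun i hi => by simp [h2 i hi, hu], fun k hk => ?_⟩
      simp [h3 k hk, h3 q hjq]
    · have hjq : j = q := Fin.ext hj
      have hu : u q = (M r q)⁻¹ - 1 := by simp [u]
      rw [hjq, Function.update_self, hu]
      refine ⟨by field_simp; ring, fun i hi => by simp [hrmax i hi], fun k hk => ?_⟩
      have huk : u k = -M r k / M r q := by simp [u, hk.not_gt, hk.ne']
      rw [huk]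
      field_simp
      ring

lemma exists_isColumnReduced_mul_upperTriangular {n : ℕ} (g : Matrix (Fin n) (Fin n) ℂ)
    (hg : IsUnit g) :
    ∃ M : Matrix (Fin n) (Fin n) ℂ, IsColumnReduced M ∧
      ∃ b : Matrix (Fin n) (Fin n) ℂ, IsUnit b ∧ b.BlockTriangular id ∧ g = M * b := by
  obtain ⟨c, w, hc, hct, h⟩ := exists_upperTriangular_mul_partially_reduced g hg n le_rfl
  have hw : Function.Injective w := by
    refine Function.Injective.of_lt_imp_ne fun j k hjk hjk' => ?_
    have h0 := (h j j.isLt).2.2 k hjk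
    rw [hjk', (h k k.isLt).1] at h0
    exact one_ne_zero h0
  let _ := hc.invertible
  refine ⟨g * c, ⟨Equiv.ofBijective w (Finite.injective_iff_bijective.1 hw),
    fun j => (h j j.isLt).1, fun i j hij hn => ?_⟩, c⁻¹, ?_,
    blockTriangular_inv_of_blockTriangular hct, ?_⟩
  · obtain ⟨k, rfl⟩ := (Finite.injective_iff_surjective.1 hw) i
    rw [Equiv.Perm.inv_def, Equiv.ofBijective_symm_apply_apply] at hn
    simp only [Equiv.ofBijective_apply] at hij hn
    rcases lt_trichotomy (w k) (w j) with hlt | heq | hgt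
    · have hkj : k ≠ j := fun e => hij (e ▸ rfl)
      exact (h k k.isLt).2.2 j (lt_of_le_of_ne (not_lt.1 fun hjk => hn ⟨hlt, hjk⟩) hkj)
    · exact absurd heq hij
    · exact (h j j.isLt).2.1 _ hgt
  · exact isUnit_nonsing_inv_iff.2 hc
  · rw [Matrix.mul_assoc, mul_nonsing_inv _ ((isUnit_iff_isUnit_det c).1 hc), Matrix.mul_one]

lemma IsColumnReduced.eq_of_eq_mul_upperTriangular {n : ℕ} {M M' b : Matrix (Fin n) (Fin n) ℂ}
    (hM : IsColumnReduced M) (hM' : IsColumnReduced M') (hb : b.BlockTriangular id)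
    (h : M' = M * b) : M' = M := by
  obtain ⟨w, h1, h0⟩ := hM
  obtain ⟨w', h1', h0'⟩ := hM'
  have hbelow : ∀ i j, w j < i → M i j = 0 := fun i j hij =>
    h0 i j hij.ne' fun hh => hh.1.not_gt hij
  have hbelow' : ∀ i j, w' j < i → M' i j = 0 := fun i j hij =>
    h0' i j hij.ne' fun hh => hh.1.not_gt hij
  have hright : ∀ k j, k < j → M (w k) j = 0 := fun k j hkj =>
    h0 _ j (fun e => hkj.ne (w.injective e)) fun hh => by simp [hkj.not_gt] at hh
  have hright' : ∀ k j, k < j → M' (w' k) j = 0 := fun k j hkj =>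
    h0' _ j (fun e => hkj.ne (w'.injective e)) fun hh => by simp [hkj.not_gt] at hh
  have hentry : ∀ i j, M' i j = ∑ k, M i k * b k j := fun i j => by rw [h, mul_apply]
  have hpivot : ∀ j, ∃ k, b k j = 1 ∧ w k = w' j := by
    intro j
    have hne : ∃ k, b k j ≠ 0 := by
      by_contra! hz
      have := h1' j
      simp [hentry, hz] at this
    obtain ⟨k, hk⟩ := (Set.toFinite {k | b k j ≠ 0}).exists_maximalFor w _ hne
    have hmax : ∀ l, w k < w l → b l j = 0 := fun l hl => by
      by_contra hl0
      exact hk.not_gt hl0 hl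
    have hval : ∀ i, w k ≤ i → M' i j = M i k * b k j := by
      intro i hi
      rw [hentry, Finset.sum_eq_single k _ (by simp)]
      intro l _ hlk
      rcases lt_or_gt_of_ne (fun e => hlk (w.injective e) : w l ≠ w k) with hl | hl
      · rw [hbelow i l (hl.trans_le hi), zero_mul]
      · rw [hmax l hl, mul_zero]
    have hv := hval (w k) le_rfl
    rw [h1, one_mul] at hv
    have hwk : w k = w' j := by
      rcases lt_trichotomy (w k) (w' j) with hlt | heq | hgt
      · have hv' := hval (w' j) hlt.le
        rw [h1', hbelow _ _ hlt, zero_mul] at hv'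
        exact absurd hv' one_ne_zero
      · exact heq
      · exact absurd (hv.symm.trans (hbelow' _ _ hgt)) hk.prop
    exact ⟨k, by rw [← hv, hwk, h1'], hwk⟩
  have hle : ∀ j, (w'.trans w.symm) j ≤ j := by
    intro j
    obtain ⟨k, hk, hkj⟩ := hpivot j
    rw [Equiv.trans_apply, ← hkj, Equiv.symm_apply_apply]
    by_contra! hlt
    rw [hb hlt] at hk
    exact zero_ne_one hk
  have hid : ∀ j, (w'.trans w.symm) j = j := by
    intro j
    induction j using WellFoundedLT.induction with
    | ind j ih =>
      refine (hle j).eq_of_not_lt fun hlt => ?_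
      exact hlt.ne ((w'.trans w.symm).injective (ih _ hlt))
  have hww : ∀ j, w' j = w j := fun j => by
    simpa [Equiv.symm_apply_eq] using hid j
  have hdiag : ∀ j, b j j = 1 := by
    intro j
    obtain ⟨k, hk, hkj⟩ := hpivot j
    rw [hww] at hkj
    rwa [w.injective hkj] at hk
  have hoff : ∀ j k, k < j → b k j = 0 := by
    intro j k
    induction k using WellFoundedLT.induction with
    | ind k ih =>
      intro hkj
      have hz := hright' k j hkj
      rw [hww, hentry, Finset.sum_eq_single k, h1, one_mul] at hz
      · exact hz
      · intro l _ hlk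
        rcases lt_or_gt_of_ne hlk with hl | hl
        · rw [ih l hl (hl.trans hkj), mul_zero]
        · rw [hright k l hl, zero_mul]
      · simp
  have hb1 : b = 1 := by
    ext i j
    rcases lt_trichotomy i j with hij | rfl | hij
    · rw [hoff j i hij, one_apply_ne hij.ne]
    · rw [hdiag, one_apply_eq]
    · rw [hb hij, one_apply_ne hij.ne']
  rw [h, hb1, Matrix.mul_one]

/-- Every invertible `n × n` complex matrix `g` factors as `g = M * b` with `M`
in column-reduced form and `b` invertible upper triangular, and the column-reduced
matrix `M` is unique. -/
theorem unique_column_reduced_representative {n : ℕ}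
    (g : Matrix (Fin n) (Fin n) ℂ) (hg : IsUnit g) :
    ∃! M : Matrix (Fin n) (Fin n) ℂ,
      IsColumnReduced M ∧
        ∃ b : Matrix (Fin n) (Fin n) ℂ,
          IsUnit b ∧ b.BlockTriangular id ∧ g = M * b := by
  obtain ⟨M, hM, b, hb, hbt, h⟩ := exists_isColumnReduced_mul_upperTriangular g hg
  refine ⟨M, ⟨hM, b, hb, hbt, h⟩, ?_⟩
  rintro M' ⟨hM', b', hb', hbt', h'⟩
  let _ := hb'.invertible
  refine hM.eq_of_eq_mul_upperTriangular hM'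
    (hbt.mul (blockTriangular_inv_of_blockTriangular hbt')) ?_
  rw [← Matrix.mul_assoc, ← h, h', Matrix.mul_assoc,
    mul_nonsing_inv _ ((isUnit_iff_isUnit_det b').1 hb'), Matrix.mul_one]
end

section
/- For every invertible n×n complex matrix g there exists a unique permutation w of {1,…,n} such that g = b₁·P_w·b₂ for some invertible upper-triangular complex matrices b₁ and b₂, where P_w is the permutation matrix with (P_w)_{i,j} = 1 if i = w(j) and 0 otherwise (Bruhat decomposition of GL_n(ℂ)). -/
open Matrix

section Bruhat

variable {n : ℕ} {K : Type*} [Field K]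

/-- The diagonal entries of an invertible upper-triangular matrix are nonzero. -/
theorem Matrix.BlockTriangular.diag_ne_zero_of_isUnit {b : Matrix (Fin n) (Fin n) K}
    (hb : b.BlockTriangular id) (hu : IsUnit b) (j : Fin n) : b j j ≠ 0 := by
  have hdet := ((Matrix.isUnit_iff_isUnit_det b).1 hu).ne_zero
  rw [Matrix.det_of_isUpperTriangular hb] at hdet
  exact Finset.prod_ne_zero_iff.1 hdet j (Finset.mem_univ j)

/-- The inverse of an invertible upper-triangular matrix is upper triangular. -/
theorem Matrix.BlockTriangular.inv_of_isUnit {b : Matrix (Fin n) (Fin n) K}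
    (hb : b.BlockTriangular id) (hu : IsUnit b) : b⁻¹.BlockTriangular id := by
  have := hu.invertible
  exact Matrix.blockTriangular_inv_of_blockTriangular hb

/-- Right multiplication by the permutation matrix of `w` permutes the columns. -/
theorem Matrix.mul_permMatrix_apply (c : Matrix (Fin n) (Fin n) K) (w : Equiv.Perm (Fin n))
    (i j : Fin n) :
    (c * (Matrix.of fun i j => if i = w j then (1 : K) else 0)) i j = c i (w j) := by
  simp [Matrix.mul_apply]

/-- Left multiplication by the permutation matrix of `w` permutes the rows. -/
theorem Matrix.permMatrix_mul_apply (b : Matrix (Fin n) (Fin n) K) (w : Equiv.Perm (Fin n))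
    (i j : Fin n) :
    ((Matrix.of fun i j => if i = w j then (1 : K) else 0) * b) (w i) j = b i j := by
  simp [Matrix.mul_apply]

/-- If the double cosets of `w` and `w'` meet, then `w ≤ w'` pointwise. -/
theorem perm_le_of_bruhat_eq {w w' : Equiv.Perm (Fin n)}
    {b₁ b₂ c₁ c₂ : Matrix (Fin n) (Fin n) K}
    (hb₁ : IsUnit b₁) (tb₁ : b₁.BlockTriangular id)
    (hb₂ : IsUnit b₂) (tb₂ : b₂.BlockTriangular id)
    (tc₁ : c₁.BlockTriangular id)
    (hc₂ : IsUnit c₂) (tc₂ : c₂.BlockTriangular id)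
    (h : b₁ * (Matrix.of fun i j => if i = w j then (1 : K) else 0) * b₂ =
      c₁ * (Matrix.of fun i j => if i = w' j then (1 : K) else 0) * c₂) (j : Fin n) :
    w j ≤ w' j := by
  have db₁ := (Matrix.isUnit_iff_isUnit_det b₁).1 hb₁
  have dc₂ := (Matrix.isUnit_iff_isUnit_det c₂).1 hc₂
  have key : (Matrix.of fun i j => if i = w j then (1 : K) else 0) * (b₂ * c₂⁻¹) =
      (b₁⁻¹ * c₁) * (Matrix.of fun i j => if i = w' j then (1 : K) else 0) := by
    have h' := congrArg (fun M => b₁⁻¹ * M * c₂⁻¹) h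
    simpa only [Matrix.mul_assoc, Matrix.nonsing_inv_mul_cancel_left _ _ db₁,
      Matrix.mul_nonsing_inv _ dc₂, Matrix.mul_one] using h'
  have hjj := congrFun (congrFun key (w j)) j
  rw [Matrix.permMatrix_mul_apply, Matrix.mul_permMatrix_apply] at hjj
  by_contra! hlt
  have tc : (b₁⁻¹ * c₁).BlockTriangular id := (tb₁.inv_of_isUnit hb₁).mul tc₁
  have tb : (b₂ * c₂⁻¹).BlockTriangular id := tb₂.mul (tc₂.inv_of_isUnit hc₂)
  exact tb.diag_ne_zero_of_isUnit (hb₂.mul (Matrix.isUnit_nonsing_inv_iff.2 hc₂)) j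
    (hjj.trans (tc hlt))

/-- A nonzero vector has a last nonzero coordinate. -/
theorem exists_last_ne_zero {u : Fin n → K} (hu : u ≠ 0) :
    ∃ l, u l ≠ 0 ∧ ∀ i, l < i → u i = 0 := by
  classical
  obtain ⟨k, hk⟩ := Function.ne_iff.1 hu
  obtain ⟨l, hl, hmax⟩ := (Set.toFinite {i | u i ≠ 0}).exists_maximal ⟨k, hk⟩
  exact ⟨l, hl, fun i hi => by_contra fun h => (hmax h hi.le).not_gt hi⟩

/-- Column reduction of an invertible matrix: after right multiplication by a unipotent
upper-triangular matrix, the last nonzero entries of the columns lie in distinct rows. -/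
theorem exists_column_reduction {g : Matrix (Fin n) (Fin n) K} (hg : IsUnit g) :
    ∃ (V : Matrix (Fin n) (Fin n) K) (w : Equiv.Perm (Fin n)),
      (∀ j, V j j = 1) ∧ V.BlockTriangular id ∧ ∀ i j, w j < i → (g * V) i j = 0 := by
  let S (j : Fin n) : Set (Fin n) := {l | ∃ v : Fin n → K, v j = 1 ∧ (∀ i, j < i → v i = 0) ∧
    (g *ᵥ v) l ≠ 0 ∧ ∀ i, l < i → (g *ᵥ v) i = 0}
  have lead (j : Fin n) (v : Fin n → K) (h1 : v j = 1) (h0 : ∀ i, j < i → v i = 0) :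
      ∃ l ∈ S j, (g *ᵥ v) l ≠ 0 := by
    have hv : g *ᵥ v ≠ 0 := fun h => by
      have : v = 0 := Matrix.mulVec_injective_of_isUnit hg (by simpa using h)
      simp [this] at h1
    obtain ⟨l, hl, hl'⟩ := exists_last_ne_zero hv
    exact ⟨l, ⟨v, h1, h0, hl, hl'⟩, hl⟩
  have hmin (j : Fin n) : ∃ l ∈ S j, ∀ l' ∈ S j, l ≤ l' := by
    obtain ⟨l, hl, -⟩ := lead j (Pi.single j 1) (by simp)
      (fun i hi => Pi.single_eq_of_ne hi.ne' 1)
    obtain ⟨m, hm, hmin⟩ := (Set.toFinite (S j)).exists_minimal ⟨l, hl⟩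
    exact ⟨m, hm, fun l' hl' => (le_total m l').elim id (hmin hl')⟩
  choose w hw hwmin using hmin
  choose v hv1 hv0 hvw hvlt using hw
  have hne (j k : Fin n) (hjk : j < k) : w j ≠ w k := fun heq => by
    let c := (g *ᵥ v k) (w k) / (g *ᵥ v j) (w j)
    obtain ⟨l, hl, hl0⟩ := lead k (v k - c • v j) (by simp [hv1, hv0 j k hjk])
      (fun i hi => by simp [hv0 k i hi, hv0 j i (hjk.trans hi)])
    apply hl0
    rw [Matrix.mulVec_sub, Matrix.mulVec_smul, Pi.sub_apply, Pi.smul_apply, smul_eq_mul]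
    rcases (hwmin k l hl).eq_or_lt with rfl | hlt
    · rw [← heq, div_mul_cancel₀ _ (hvw j), heq, sub_self]
    · rw [hvlt k l hlt, hvlt j l (heq ▸ hlt), mul_zero, sub_zero]
  have hinj : Function.Injective w := fun j k h => by
    rcases lt_trichotomy j k with hjk | hjk | hjk
    · exact absurd h (hne j k hjk)
    · exact hjk
    · exact absurd h.symm (hne k j hjk)
  exact ⟨Matrix.of fun i j => v j i,
    Equiv.ofBijective w (Finite.injective_iff_bijective.1 hinj), hv1,
    fun i j hij => hv0 j i hij, fun i j hij => hvlt j i hij⟩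

end Bruhat

/-- Bruhat decomposition of `GL_n(ℂ)`: every invertible complex matrix `g` lies in
exactly one double coset `B · P_w · B` of the Borel subgroup `B` of invertible
upper-triangular matrices, where `P_w` is the permutation matrix with
`(P_w) i j = 1` iff `i = w j`. -/
theorem bruhat_decomposition {n : ℕ}
    (g : Matrix (Fin n) (Fin n) ℂ) (hg : IsUnit g) :
    ∃! w : Equiv.Perm (Fin n),
      ∃ b₁ b₂ : Matrix (Fin n) (Fin n) ℂ,
        IsUnit b₁ ∧ b₁.BlockTriangular id ∧
        IsUnit b₂ ∧ b₂.BlockTriangular id ∧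
        g = b₁ * (Matrix.of fun i j => if i = w j then (1 : ℂ) else 0) * b₂ := by
  obtain ⟨V, w, hV1, tV, hVw⟩ := exists_column_reduction hg
  have dV : IsUnit V.det := by simp [Matrix.det_of_isUpperTriangular tV, hV1]
  have hV : IsUnit V := (Matrix.isUnit_iff_isUnit_det V).2 dV
  refine existsUnique_of_exists_of_unique ⟨w, (g * V).submatrix id w.symm, V⁻¹, ?_, ?_,
    Matrix.isUnit_nonsing_inv_iff.2 hV, tV.inv_of_isUnit hV, ?_⟩ ?_
  · exact (Matrix.isUnit_submatrix_equiv (Equiv.refl _) w.symm).2 (hg.mul hV)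
  · exact fun i j hij => hVw i (w.symm j) (by simpa using hij)
  · have h : (g * V).submatrix id w.symm *
        (Matrix.of fun i j => if i = w j then (1 : ℂ) else 0) = g * V := by
      ext i j
      rw [Matrix.mul_permMatrix_apply]
      simp
    rw [h, Matrix.mul_nonsing_inv_cancel_right _ _ dV]
  · rintro w w' ⟨b₁, b₂, hb₁, tb₁, hb₂, tb₂, hb⟩ ⟨c₁, c₂, hc₁, tc₁, hc₂, tc₂, hc⟩
    have h := hb.symm.trans hc
    exact Equiv.ext fun j => le_antisymm
      (perm_le_of_bruhat_eq hb₁ tb₁ hb₂ tb₂ tc₁ hc₂ tc₂ h j)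
      (perm_le_of_bruhat_eq hc₁ tc₁ hc₂ tc₂ tb₁ hb₂ tb₂ h.symm j)
end

section
/- Let X : ℂ³ → ℂ³ be the linear map with X(e₃) = e₁ and X(e₁) = X(e₂) = 0 (the matrix E₁₃). A complete flag V₁ ⊆ V₂ ⊆ ℂ³ is X-invariant if and only if V₁ ⊆ ker X and (range X ⊆ V₂ or V₂ = ker X). (This describes the Springer fiber of E₁₃, which is two spheres joined at a single common point.) -/
/-- Let `X : ℂ³ → ℂ³` be the matrix `E₁₃`, i.e. `X e₃ = e₁`, `X e₁ = X e₂ = 0`.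
A complete flag `V₁ ⊆ V₂ ⊆ ℂ³` is `X`-invariant iff `V₁ ⊆ ker X` and
(`range X ⊆ V₂` or `V₂ = ker X`).  This describes the Springer fiber of `E₁₃`,
two spheres joined at a single common point. -/
theorem springer_fiber_E13 (X : (Fin 3 → ℂ) →ₗ[ℂ] (Fin 3 → ℂ))
    (hX3 : X (Pi.single (2 : Fin 3) (1 : ℂ)) = Pi.single (0 : Fin 3) (1 : ℂ))
    (hX1 : X (Pi.single (0 : Fin 3) (1 : ℂ)) = 0)
    (hX2 : X (Pi.single (1 : Fin 3) (1 : ℂ)) = 0)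
    (V₁ V₂ : Submodule ℂ (Fin 3 → ℂ)) (hle : V₁ ≤ V₂)
    (hd1 : Module.finrank ℂ V₁ = 1) (hd2 : Module.finrank ℂ V₂ = 2) :
    ((∀ x ∈ V₁, X x ∈ V₁) ∧ (∀ x ∈ V₂, X x ∈ V₂)) ↔
      (V₁ ≤ LinearMap.ker X ∧
        (LinearMap.range X ≤ V₂ ∨ V₂ = LinearMap.ker X)) := by
  have hX : ∀ v, X v = v 2 • Pi.single (0 : Fin 3) (1 : ℂ) := by
    intro v
    conv_lhs => rw [pi_eq_sum_univ' v]
    simp [Fin.sum_univ_three, hX1, hX2, hX3]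
  have hXX : ∀ v, X (X v) = 0 := fun v => by rw [hX v, map_smul, hX1, smul_zero]
  constructor
  · rintro ⟨h₁, h₂⟩
    refine ⟨fun x hx => ?_, ?_⟩
    · obtain ⟨v, -, hv⟩ := finrank_eq_one_iff'.mp hd1
      obtain ⟨c, hc⟩ := hv ⟨X v, h₁ v v.2⟩
      obtain ⟨d, hd⟩ := hv ⟨x, hx⟩
      have hc' : c • (v : Fin 3 → ℂ) = X v := congrArg Subtype.val hc
      have hd' : d • (v : Fin 3 → ℂ) = x := congrArg Subtype.val hd
      have hXv : X v = 0 := by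
        have h := hXX v
        rw [← hc', map_smul] at h
        rcases smul_eq_zero.mp h with h | h
        · rw [← hc', h, zero_smul]
        · exact h
      rw [LinearMap.mem_ker, ← hd', map_smul, hXv, smul_zero]
    · by_cases hker : V₂ ≤ LinearMap.ker X
      · right
        have htop : LinearMap.ker X ≠ ⊤ := by
          intro h
          rw [LinearMap.ker_eq_top.mp h] at hX3
          simpa using congrFun hX3 0
        have hlt := Submodule.finrank_lt htop
        rw [Module.finrank_fin_fun] at hlt
        exact Submodule.eq_of_le_of_finrank_le hker (by omega)
      · left
        obtain ⟨x, hx, hxk⟩ := SetLike.not_le_iff_exists.mp hker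
        rw [LinearMap.mem_ker, hX x] at hxk
        have hx2 : x 2 ≠ 0 := fun h => hxk (by rw [h, zero_smul])
        have he := h₂ x hx
        rw [hX x, V₂.smul_mem_iff hx2] at he
        rintro _ ⟨y, rfl⟩
        rw [hX y]
        exact V₂.smul_mem _ he
  · rintro ⟨h₁, h₂⟩
    refine ⟨fun x hx => ?_, fun x hx => ?_⟩
    · rw [LinearMap.mem_ker.mp (h₁ hx)]
      exact V₁.zero_mem
    · rcases h₂ with h₂ | h₂
      · exact h₂ ⟨x, rfl⟩
      · rw [h₂] at hx
        rw [LinearMap.mem_ker.mp hx]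
        exact V₂.zero_mem
end
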